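/- Suppose there exist constants 0 < C₁ < C₂ such that for every η with 0 < η ≤ min(ε₁, β/(C₂+1)) the open interval (C₁, C₂) is disjoint from the spectrum of η⁻¹H̃(η). Set C₀ := (C₂+1)² · (sup_{η ∈ [0,ε₁]} ‖H(η)Π(η)‖)² · β⁻³ and ε₀ := min(ε₁, β/(C₂+1), (C₂−C₁)/(2C₀)). Then for every η ∈ (0, ε₀) the open interval (C₁η + C₀η², C₂η − C₀η²) is disjoint from σ(H(η)). -/

import Mathlib

noncomputable section

open MeasureTheory
open scoped ComplexOrder

/-- The abstract Feshbach–Schur setup: a densely defined nonnegative self-adjoint operator `H`,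
an orthogonal projection `P` (denoted `Π`) with range in the domain of `H`, a bounded operator
`T = HΠ`, and a lower bound `Π⊥ H Π⊥ ≥ 2β Π⊥`. -/
structure FeshbachSetup (ℋ : Type*) [NormedAddCommGroup ℋ] [InnerProductSpace ℂ ℋ]
    [CompleteSpace ℋ] (β : ℝ) : Type _ where
  H : ℋ →ₗ.[ℂ] ℋ
  dense_dom : Dense (H.domain : Set ℋ)
  selfAdjoint : IsSelfAdjoint H
  nonneg : ∀ u : H.domain, 0 ≤ (inner ℂ (u : ℋ) (H u) : ℂ)
  P : ℋ →L[ℂ] ℋ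
  P_idem : P.comp P = P
  P_sa : ContinuousLinearMap.adjoint P = P
  memP : ∀ x : ℋ, P x ∈ H.domain
  T : ℋ →L[ℂ] ℋ
  T_eq : ∀ x : ℋ, T x = H ⟨P x, memP x⟩
  β_pos : 0 < β
  lower : ∀ u : H.domain,
    ((2 * β * ‖(u : ℋ) - P u‖ ^ 2 : ℝ) : ℂ) ≤
      inner ℂ ((u : ℋ) - P u) (H ⟨(u : ℋ) - P u, H.domain.sub_mem u.2 (memP u)⟩)

namespace FeshbachSetup

variable {ℋ : Type*} [NormedAddCommGroup ℋ] [InnerProductSpace ℂ ℋ] [CompleteSpace ℋ]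
variable {β : ℝ} (S : FeshbachSetup ℋ β)

/-- `R` witnesses that `H - E` is a bijection from the domain of `H` onto `ℋ`
with bounded inverse `R`. -/
def IsInvWitness (E : ℝ) (R : ℋ →L[ℂ] ℋ) : Prop :=
  (∀ u : S.H.domain, R (S.H u - (E : ℂ) • (u : ℋ)) = u) ∧
  (∀ y : ℋ, ∃ h : R y ∈ S.H.domain, S.H ⟨R y, h⟩ - (E : ℂ) • R y = y)

/-- `H - E` is a bijection from the domain of `H` onto `ℋ` with bounded inverse. -/
def IsInvertibleAt (E : ℝ) : Prop := ∃ R, S.IsInvWitness E R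

/-- the spectrum `σ(H)` (as a subset of `ℝ`). -/
def spec : Set ℝ := {E | ¬ S.IsInvertibleAt E}

/-- the bounded operator `Π⊥ H Π`. -/
def A : ℋ →L[ℂ] ℋ := (1 - S.P).comp S.T

/-- `R : ℝ → 𝓛(ℋ)` is the family of reduced resolvents `E ↦ R⊥(E)`:  for `E ∈ [0, 2β)`,
`R E` is supported on `Π⊥ℋ` and is there a two-sided inverse of `Π⊥(H - E)Π⊥`. -/
def IsRedResolvent (R : ℝ → (ℋ →L[ℂ] ℋ)) : Prop :=
  ∀ E ∈ Set.Ico (0 : ℝ) (2 * β),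
    ((1 - S.P).comp ((R E).comp (1 - S.P)) = R E) ∧
    (∀ u : S.H.domain,
      R E ((1 - S.P)
          (S.H ⟨(u : ℋ) - S.P u, S.H.domain.sub_mem u.2 (S.memP u)⟩
            - (E : ℂ) • ((u : ℋ) - S.P u)))
        = (u : ℋ) - S.P u) ∧
    (∀ y : ℋ, ∃ h : R E y ∈ S.H.domain,
      (1 - S.P) (S.H ⟨R E y, h⟩ - (E : ℂ) • R E y) = (1 - S.P) y)

/-- `Y = Π + ΠHΠ⊥ R⊥(0)² Π⊥HΠ`, as an operator on `ℋ` vanishing on `Π⊥ℋ`. -/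
def Y (R : ℝ → (ℋ →L[ℂ] ℋ)) : ℋ →L[ℂ] ℋ :=
  S.P + (ContinuousLinearMap.adjoint S.A).comp ((R 0).comp ((R 0).comp S.A))

/-- `G` is `Y^{-1/2} ∈ 𝓛(Πℋ)`, extended by `0` on `Π⊥ℋ`:  `G` is supported on `Πℋ`,
self-adjoint, nonnegative, and `G Y G = Π`. -/
def IsYInvSqrt (R : ℝ → (ℋ →L[ℂ] ℋ)) (G : ℋ →L[ℂ] ℋ) : Prop :=
  S.P.comp (G.comp S.P) = G ∧
  ContinuousLinearMap.adjoint G = G ∧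
  (∀ x : ℋ, 0 ≤ (inner ℂ x (G x) : ℂ)) ∧
  G.comp ((S.Y R).comp G) = S.P

/-- the dressed operator `H̃ = Y^{-1/2}[ΠHΠ - ΠHΠ⊥R⊥(0)Π⊥HΠ]Y^{-1/2}`,
extended by `0` on `Π⊥ℋ`. -/
def Htilde (R : ℝ → (ℋ →L[ℂ] ℋ)) (G : ℋ →L[ℂ] ℋ) : ℋ →L[ℂ] ℋ :=
  G.comp (((S.P.comp S.T) - (ContinuousLinearMap.adjoint S.A).comp ((R 0).comp S.A)).comp G)

end FeshbachSetup

/-- `V` is a two-sided inverse of `W` in the corner algebra `Π 𝓛(ℋ) Π` (with unit `P`),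
i.e. `W` viewed as an operator on `Πℋ` is invertible with inverse `V`. -/
def IsCornerInv {ℋ : Type*} [NormedAddCommGroup ℋ] [InnerProductSpace ℂ ℋ]
    (P W V : ℋ →L[ℂ] ℋ) : Prop :=
  P.comp (V.comp P) = V ∧ V.comp W = P ∧ W.comp V = P

/-- the spectrum of an operator `W` supported on `Πℋ`, viewed as a bounded operator
on `Πℋ` (as a subset of `ℝ`). -/
def cornerSpec {ℋ : Type*} [NormedAddCommGroup ℋ] [InnerProductSpace ℂ ℋ]
    (P W : ℋ →L[ℂ] ℋ) : Set ℝ :=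
  {E : ℝ | ¬ ∃ V, IsCornerInv P (W - (E : ℂ) • P) V}


namespace FeshbachSetup

section helpers
variable {ℋ : Type*} [NormedAddCommGroup ℋ] [InnerProductSpace ℂ ℋ] [CompleteSpace ℋ]
variable {β : ℝ} (S : FeshbachSetup ℋ β)

theorem symm_H (u v : S.H.domain) : inner ℂ (S.H u) (v : ℋ) = inner ℂ (u : ℋ) (S.H v) := by
  have h := LinearPMap.adjoint_isFormalAdjoint S.dense_dom
  have h2 := LinearPMap.isSelfAdjoint_def.1 S.selfAdjoint
  rw [h2] at h
  exact h u v

theorem P_P (x : ℋ) : S.P (S.P x) = S.P x := by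
  have := congrArg (fun f : ℋ →L[ℂ] ℋ => f x) S.P_idem
  simpa using this

theorem P_symm (x y : ℋ) : inner ℂ (S.P x) y = inner ℂ x (S.P y) := by
  have := ContinuousLinearMap.adjoint_inner_left S.P y x
  rwa [S.P_sa] at this

theorem H_congr {x y : ℋ} (h : x = y) (hx : x ∈ S.H.domain) (hy : y ∈ S.H.domain) :
    S.H ⟨x, hx⟩ = S.H ⟨y, hy⟩ := by subst h; rfl

theorem T_P (x : ℋ) : S.T (S.P x) = S.T x := by
  rw [S.T_eq, S.T_eq]; exact S.H_congr (S.P_P x) _ _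

theorem A_apply (x : ℋ) : S.A x = S.T x - S.P (S.T x) := by simp [A]

theorem A_P (x : ℋ) : S.A (S.P x) = S.A x := by simp [A_apply, T_P]

theorem P_A (x : ℋ) : S.P (S.A x) = 0 := by simp [A_apply, P_P]

theorem P_Aadj (x : ℋ) : S.P (ContinuousLinearMap.adjoint S.A x) =
    ContinuousLinearMap.adjoint S.A x := by
  refine ext_inner_left ℂ fun v => ?_
  rw [← S.P_symm, ContinuousLinearMap.adjoint_inner_right, ContinuousLinearMap.adjoint_inner_right,
    A_P]

theorem Aadj_apply (z : ℋ) (hz : z ∈ S.H.domain) (hPz : S.P z = 0) :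
    ContinuousLinearMap.adjoint S.A z = S.P (S.H ⟨z, hz⟩) := by
  refine ext_inner_left ℂ fun v => ?_
  rw [← S.P_symm, ContinuousLinearMap.adjoint_inner_right, A_apply, inner_sub_left,
    S.P_symm (S.T v) z, hPz, inner_zero_right, sub_zero, S.T_eq]
  exact S.symm_H ⟨S.P v, S.memP v⟩ ⟨z, hz⟩

theorem Aadj_P (x : ℋ) : ContinuousLinearMap.adjoint S.A (S.P x) = 0 := by
  refine ext_inner_left ℂ fun v => ?_
  rw [ContinuousLinearMap.adjoint_inner_right, ← S.P_symm, P_A]; simp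

theorem PT_symm (x y : ℋ) : inner ℂ (S.P (S.T x)) y = inner ℂ x (S.P (S.T y)) := by
  rw [S.P_symm, ← S.P_symm x, S.T_eq, S.T_eq]
  exact S.symm_H ⟨S.P x, S.memP x⟩ ⟨S.P y, S.memP y⟩

theorem norm_P_le (x : ℋ) : ‖S.P x‖ ≤ ‖x‖ := by
  have h : (‖S.P x‖:ℝ) ^ 2 ≤ ‖x‖ * ‖S.P x‖ := by
    have h1 : inner ℂ (S.P x) (S.P x) = inner ℂ x (S.P x) := by rw [S.P_symm, P_P]
    have h2 := norm_inner_le_norm (𝕜 := ℂ) x (S.P x)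
    rw [← h1, inner_self_eq_norm_sq_to_K] at h2
    simpa using h2
  by_contra! hc
  nlinarith [norm_nonneg x, norm_nonneg (S.P x)]

theorem norm_sub_P_le (x : ℋ) : ‖x - S.P x‖ ≤ ‖x‖ := by
  have h : (‖x - S.P x‖:ℝ) ^ 2 ≤ ‖x‖ * ‖x - S.P x‖ := by
    have h1 : inner ℂ (x - S.P x) (x - S.P x) = inner ℂ x (x - S.P x) := by
      rw [inner_sub_left, S.P_symm, map_sub, P_P, sub_self, inner_zero_right, sub_zero]
    have h2 := norm_inner_le_norm (𝕜 := ℂ) x (x - S.P x)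
    rw [← h1, inner_self_eq_norm_sq_to_K] at h2
    simpa using h2
  by_contra! hc
  nlinarith [norm_nonneg x, norm_nonneg (x - S.P x)]

theorem norm_A_le (x : ℋ) : ‖S.A x‖ ≤ ‖S.T‖ * ‖x‖ := by
  rw [A_apply]; exact (S.norm_sub_P_le _).trans (S.T.le_opNorm x)

variable {S} {R : ℝ → (ℋ →L[ℂ] ℋ)} (hR : S.IsRedResolvent R)
  {E : ℝ} (hE : E ∈ Set.Ico (0 : ℝ) (2 * β))

include hR hE

theorem R_eq (x : ℋ) : (R E (x - S.P x)) - S.P (R E (x - S.P x)) = R E x := by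
  have := congrArg (fun f : ℋ →L[ℂ] ℋ => f x) (hR E hE).1
  exact this

theorem P_R (x : ℋ) : S.P (R E x) = 0 := by
  rw [← R_eq hR hE x, map_sub, P_P, sub_self]

theorem R_P (x : ℋ) : R E (S.P x) = 0 := by
  rw [← R_eq hR hE (S.P x), P_P]; simp

theorem R_mem (x : ℋ) : R E x ∈ S.H.domain := ((hR E hE).2.2 x).1

theorem H_R (x : ℋ) : S.H ⟨R E x, R_mem hR hE x⟩ - (E:ℂ) • R E x =
    x - S.P x + ContinuousLinearMap.adjoint S.A (R E x) := by
  obtain ⟨h, h2⟩ := (hR E hE).2.2 x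
  rw [S.Aadj_apply _ h (P_R hR hE x)]
  have h3 : S.H ⟨R E x, h⟩ - (E:ℂ) • R E x - S.P (S.H ⟨R E x, h⟩) = x - S.P x := by
    simpa [P_R hR hE x] using h2
  rw [← h3]; abel

theorem R_H (z : ℋ) (hz : z ∈ S.H.domain) (hPz : S.P z = 0) :
    R E (S.H ⟨z, hz⟩ - (E:ℂ) • z) = z := by
  have h := (hR E hE).2.1 ⟨z, hz⟩
  have h2 : z - S.P z = z := by rw [hPz, sub_zero]
  have h3 := S.H_congr h2 (S.H.domain.sub_mem hz (S.memP z)) hz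
  simp only [h3] at h
  simp only [hPz, sub_zero] at h
  rw [_root_.sub_apply, map_sub, R_P hR hE, sub_zero] at h
  exact h

theorem R_symm (x y : ℋ) : inner ℂ (R E x) y = inner ℂ x (R E y) := by
  have key : ∀ x y : ℋ, inner ℂ (R E x) (S.H ⟨R E y, R_mem hR hE y⟩ - (E:ℂ) • R E y)
      = inner ℂ (R E x) y := by
    intro x y
    rw [H_R hR hE, inner_add_right, inner_sub_right, ← S.P_symm, P_R hR hE,
      ContinuousLinearMap.adjoint_inner_right, ← S.A_P, P_R hR hE]
    simp
  have k2 : inner ℂ (S.H ⟨R E x, R_mem hR hE x⟩ - (E:ℂ) • R E x) (R E y)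
      = inner ℂ x (R E y) := by
    rw [← inner_conj_symm, key, inner_conj_symm]
  rw [← key, ← k2, inner_sub_left, inner_sub_right, inner_smul_left, inner_smul_right,
    S.symm_H ⟨R E x, R_mem hR hE x⟩ ⟨R E y, R_mem hR hE y⟩]
  simp

theorem R_adj : ContinuousLinearMap.adjoint (R E) = R E := by
  refine ContinuousLinearMap.ext fun x => ext_inner_left ℂ fun v => ?_
  rw [ContinuousLinearMap.adjoint_inner_right, R_symm hR hE]

theorem norm_R_le (hEβ : E ≤ β) (x : ℋ) : ‖R E x‖ ≤ β⁻¹ * ‖x‖ := by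
  have hβ := S.β_pos
  set v := R E x with hv
  have h0 : v - S.P v = v := by rw [hv, P_R hR hE, sub_zero]
  have hl := S.lower ⟨v, R_mem hR hE x⟩
  have h3 := S.H_congr h0 (S.H.domain.sub_mem (R_mem hR hE x) (S.memP v)) (R_mem hR hE x)
  simp only [h0] at hl
  have h4 : S.H ⟨v, R_mem hR hE x⟩ = (E:ℂ) • v + (x - S.P x +
      ContinuousLinearMap.adjoint S.A v) := by
    rw [← H_R hR hE x]; abel
  rw [h4, inner_add_right, inner_add_right, inner_sub_right, ← S.P_symm,
      ContinuousLinearMap.adjoint_inner_right, ← S.A_P, P_R hR hE, inner_smul_right,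
      inner_self_eq_norm_sq_to_K] at hl
  have h5 := (Complex.le_def.1 hl).1
  have h6 : (inner ℂ v x).re ≤ ‖v‖ * ‖x‖ := (Complex.re_le_norm _).trans (norm_inner_le_norm v x)
  have h7 : 2 * β * ‖v‖ ^ 2 ≤ E * ‖v‖ ^ 2 + (inner ℂ v x).re := by
    have e1 : ((2 * β * ‖v‖ ^ 2 : ℝ) : ℂ).re = 2 * β * ‖v‖ ^ 2 := Complex.ofReal_re _
    have e2 : ((E : ℂ) * ((‖v‖ : ℝ) : ℂ) ^ 2).re = E * ‖v‖ ^ 2 := by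
      rw [← Complex.ofReal_pow, ← Complex.ofReal_mul, Complex.ofReal_re]
    rw [e1] at h5
    refine h5.trans (le_of_eq ?_)
    rw [← e2]
    simp
  have h8 : β * ‖v‖ ^ 2 ≤ ‖v‖ * ‖x‖ := by nlinarith [sq_nonneg ‖v‖]
  rw [inv_mul_eq_div, le_div_iff₀ hβ]
  by_contra! hc
  have hvpos : 0 < ‖v‖ := by
    rcases (norm_nonneg v).eq_or_lt with h | h
    · rw [← h] at hc; nlinarith [norm_nonneg x]
    · exact h
  nlinarith

theorem res_id {b : ℝ} (hb : b ∈ Set.Ico (0 : ℝ) (2 * β)) (y : ℋ) :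
    R b y = R E y + ((b:ℂ) - E) • R E (R b y) := by
  have h := R_H hR hE (R b y) (R_mem hR hb y) (P_R hR hb y)
  have h4 : S.H ⟨R b y, R_mem hR hb y⟩ - (E:ℂ) • R b y = ((b:ℂ) - E) • R b y + (y - S.P y +
      S.P (S.H ⟨R b y, R_mem hR hb y⟩)) := by
    rw [← S.Aadj_apply _ _ (P_R hR hb y), ← H_R hR hb y, sub_smul]; abel
  rw [h4] at h
  simp only [map_add, map_sub, R_P hR hE, map_smul] at h
  rw [sub_zero, add_zero] at h
  rw [add_comm, h]

/-- Feshbach–Schur: invertibility. -/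
theorem feshbach (V : ℋ →L[ℂ] ℋ)
    (hV : IsCornerInv S.P (S.P.comp S.T - (E:ℂ) • S.P -
      (ContinuousLinearMap.adjoint S.A).comp ((R E).comp S.A)) V) : S.IsInvertibleAt E := by
  obtain ⟨hV1, hV2, hV3⟩ := hV
  have v1 : ∀ x, S.P (V x) = V x := fun x => by
    have := congrArg (fun f : ℋ →L[ℂ] ℋ => S.P (f x)) hV1
    simp [S.P_P] at this
    have h2 := congrArg (fun f : ℋ →L[ℂ] ℋ => f x) hV1
    simp at h2
    rw [← this, h2]
  have v2 : ∀ x, V (S.P (S.T x) - (E:ℂ) • S.P x -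
      ContinuousLinearMap.adjoint S.A (R E (S.A x))) = S.P x := fun x => by
    have := congrArg (fun f : ℋ →L[ℂ] ℋ => f x) hV2
    simpa only [ContinuousLinearMap.comp_apply, _root_.sub_apply,
      _root_.smul_apply] using this
  have v3 : ∀ x, (S.P (S.T (V x)) - (E:ℂ) • S.P (V x) -
      ContinuousLinearMap.adjoint S.A (R E (S.A (V x)))) = S.P x := fun x => by
    have := congrArg (fun f : ℋ →L[ℂ] ℋ => f x) hV3
    simpa only [ContinuousLinearMap.comp_apply, _root_.sub_apply,
      _root_.smul_apply] using this
  refine ⟨(S.P - (R E).comp S.A).comp (V.comp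
    (S.P - (ContinuousLinearMap.adjoint S.A).comp (R E))) + R E, ?_, ?_⟩
  · intro u
    have hz : (u:ℋ) - S.P u ∈ S.H.domain := S.H.domain.sub_mem u.2 (S.memP u)
    set z : ℋ := (u:ℋ) - S.P u with hzdef
    have hPz : S.P z = 0 := by rw [hzdef, map_sub, S.P_P, sub_self]
    have hu : S.H u = S.T u + S.H ⟨z, hz⟩ := by
      rw [S.T_eq, ← LinearPMap.map_add]
      congr 1
      ext
      simp [hzdef]
    set y := S.H u - (E:ℂ) • (u:ℋ) with hy
    have hy2 : y = S.T u - (E:ℂ) • S.P u + (S.H ⟨z, hz⟩ - (E:ℂ) • z) := by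
      have hus : (u:ℋ) = S.P u + z := by rw [hzdef]; abel
      have : (E:ℂ) • (u:ℋ) = (E:ℂ) • S.P u + (E:ℂ) • z := by rw [← smul_add, ← hus]
      rw [hy, hu, this]; abel
    have hRT : R E (S.T u) = R E (S.A u) := by
      rw [S.A_apply, map_sub, R_P hR hE, sub_zero]
    have hRy : R E y = R E (S.A u) + z := by
      rw [hy2, map_add, R_H hR hE z hz hPz, map_sub, map_smul, R_P hR hE, hRT]; simp
    have hPy : S.P y = S.P (S.T u) - (E:ℂ) • S.P u + ContinuousLinearMap.adjoint S.A z := by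
      rw [hy2, S.Aadj_apply z hz hPz]
      simp [S.P_P, hPz]
    have hF : S.P y - ContinuousLinearMap.adjoint S.A (R E y) = S.P (S.T u) - (E:ℂ) • S.P u -
      ContinuousLinearMap.adjoint S.A (R E (S.A u)) := by
      rw [hPy, hRy, map_add]; abel
    simp only [ContinuousLinearMap.comp_apply, _root_.sub_apply,
      _root_.add_apply]
    rw [hF, v2, S.P_P, S.A_P, hRy, hzdef]; abel
  · intro y
    set w := V (S.P y - ContinuousLinearMap.adjoint S.A (R E y)) with hw
    have hPw : S.P w = w := v1 _
    have hval : ((S.P - (R E).comp S.A).comp (V.comp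
      (S.P - (ContinuousLinearMap.adjoint S.A).comp (R E))) + R E) y = S.P w + R E (y - S.A w) := by
      simp only [ContinuousLinearMap.comp_apply, _root_.sub_apply,
        _root_.add_apply, ← hw, map_sub]
      abel
    have hmem := S.H.domain.add_mem (S.memP w) (R_mem hR hE (y - S.A w))
    rw [hval]
    refine ⟨hmem, ?_⟩
    have hadd : S.H ⟨_, hmem⟩ = S.T w + S.H ⟨_, R_mem hR hE (y - S.A w)⟩ := by
      rw [S.T_eq, ← LinearPMap.map_add]
      rfl
    have h1 := H_R hR hE (y - S.A w)
    rw [sub_eq_iff_eq_add] at h1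
    have h2 := v3 (S.P y - ContinuousLinearMap.adjoint S.A (R E y))
    rw [← hw, map_sub, S.P_P, S.P_Aadj] at h2
    have h2' : S.P (S.T w) = S.P y - ContinuousLinearMap.adjoint S.A (R E y) + (E:ℂ) • S.P w +
      ContinuousLinearMap.adjoint S.A (R E (S.A w)) := by
      rw [← h2]; abel
    have h3 : S.T w = S.A w + S.P (S.T w) := by rw [S.A_apply]; abel
    rw [hadd, h1, h3, h2', smul_add]
    simp only [map_sub, S.P_A]
    abel

theorem R_expand (h0 : (0:ℝ) ∈ Set.Ico (0 : ℝ) (2 * β)) (y : ℋ) :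
    R E y = R 0 y + (E:ℂ) • R 0 (R 0 y) + ((E:ℂ)^2) • R 0 (R E (R 0 y)) := by
  have h1 := res_id hR h0 hE y
  have h2 := res_id hR hE h0 y
  rw [Complex.ofReal_zero, sub_zero] at h1
  rw [Complex.ofReal_zero, zero_sub, neg_smul] at h2
  have h3 : R E y = R 0 y + (E:ℂ) • R E (R 0 y) := by
    exact (eq_add_of_sub_eq (by rw [sub_eq_add_neg]; exact h2.symm))
  conv_lhs => rw [h1]
  conv_lhs => rw [h3]
  rw [map_add, map_smul, smul_add, smul_smul, pow_two, add_assoc]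

end helpers
end FeshbachSetup

theorem corner_pert {ℋ : Type*} [NormedAddCommGroup ℋ] [InnerProductSpace ℂ ℋ]
    [CompleteSpace ℋ] (P W K : ℋ →L[ℂ] ℋ) (hP : P * P = P) (hPs : IsSelfAdjoint P)
    (hW : IsSelfAdjoint W) (hPW : P * W = W) (hWP : W * P = W) (hPK : P * K = K) (hKP : K * P = K)
    {a b E : ℝ} (hgap : ∀ e ∈ Set.Ioo a b, ∃ V, IsCornerInv P (W - (e : ℂ) • P) V)
    (h1 : ‖K‖ < E - a) (h2 : ‖K‖ < b - E) :
    ∃ V, IsCornerInv P (W - (E:ℂ) • P - K) V := by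
  set B : ℋ →L[ℂ] ℋ := W + (b:ℂ) • (1 - P) with hB
  have hBs : IsSelfAdjoint B := by
    refine hW.add (IsSelfAdjoint.smul ?_ ((IsSelfAdjoint.one _).sub hPs))
    exact Complex.conj_ofReal b
  have hK0 := norm_nonneg K
  have hspec : ∀ x ∈ spectrum ℝ B, x ≤ a ∨ b ≤ x := by
    intro x hx
    by_contra! hc
    apply hx
    obtain ⟨V, hV1, hV2, hV3⟩ := hgap x hc
    have hV1 : P * (V * P) = V := hV1
    have hV2 : V * (W - (x:ℂ) • P) = P := hV2
    have hV3 : (W - (x:ℂ) • P) * V = P := hV3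
    have hPV : P * V = V := by rw [← hV1, ← mul_assoc, hP]
    have hVP : V * P = V := by
      conv_rhs => rw [← hV1]
      conv_lhs => rw [← hV1]
      simp only [mul_assoc, hP]
    have hne : ((b:ℂ) - x) ≠ 0 := by
      rw [← Complex.ofReal_sub]; exact_mod_cast (sub_pos.2 hc.2).ne'
    have hx1 : (algebraMap ℝ (ℋ →L[ℂ] ℋ)) x = (x:ℂ) • 1 := by
      rw [Algebra.algebraMap_eq_smul_one, Complex.coe_smul]
    have hQ : (1 - P) * (1 - P) = 1 - P := by
      rw [mul_sub, sub_mul, sub_mul, hP]; simp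
    have e1 : B - (x:ℂ) • 1 = (W - (x:ℂ) • P) + ((b:ℂ) - x) • (1 - P) := by
      rw [hB]; module
    have q1 : (W - (x:ℂ) • P) * (1 - P) = 0 := by
      rw [mul_sub, mul_one, sub_mul, smul_mul_assoc, hP, hWP]; simp
    have q2 : (1 - P) * (W - (x:ℂ) • P) = 0 := by
      rw [sub_mul, mul_sub P, mul_smul_comm, hP, hPW]; simp
    have q3 : V * (1 - P) = 0 := by rw [mul_sub, hVP]; simp
    have q4 : (1 - P) * V = 0 := by rw [sub_mul, hPV]; simp
    have hu : IsUnit (B - (x:ℂ) • 1) := by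
      refine ⟨⟨B - (x:ℂ) • 1, V + ((b:ℂ) - x)⁻¹ • (1 - P), ?_, ?_⟩, rfl⟩
      · rw [e1, add_mul, mul_add, mul_add, hV3, mul_smul_comm, q1, smul_mul_assoc, q4,
          smul_mul_assoc, mul_smul_comm, hQ, smul_smul, mul_inv_cancel₀ hne]
        simp
      · rw [e1, add_mul, mul_add, mul_add, hV2, mul_smul_comm, q3, smul_mul_assoc, q2,
          smul_mul_assoc, mul_smul_comm, hQ, smul_smul, inv_mul_cancel₀ hne]
        simp
    change IsUnit (algebraMap ℝ (ℋ →L[ℂ] ℋ) x - B)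
    rw [hx1, ← neg_sub]
    exact hu.neg
  have hne : ∀ x ∈ spectrum ℝ B, x - E ≠ 0 := by
    intro x hx h
    rcases hspec x hx with h' | h' <;> linarith
  have hcont : ContinuousOn (fun x : ℝ => (x - E)⁻¹) (spectrum ℝ B) :=
    ContinuousOn.inv₀ (by fun_prop) hne
  set L := cfc (fun x : ℝ => (x - E)⁻¹) B with hL
  have hBE : cfc (fun x : ℝ => x - E) B = B - (E:ℂ) • 1 := by
    rw [cfc_sub (fun x : ℝ => x) (fun _ => E) B, cfc_id' ℝ B, cfc_const E B,
      Algebra.algebraMap_eq_smul_one, Complex.coe_smul]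
  have hBL : (B - (E:ℂ) • 1) * L = 1 := by
    rw [← hBE, hL, ← cfc_mul _ _ B (by fun_prop) hcont, ← cfc_one ℝ B]
    refine cfc_congr fun x hx => ?_
    simp [mul_inv_cancel₀ (hne x hx)]
  have hLB : L * (B - (E:ℂ) • 1) = 1 := by
    rw [← hBE, hL, ← cfc_mul _ _ B hcont (by fun_prop), ← cfc_one ℝ B]
    refine cfc_congr fun x hx => ?_
    simp [inv_mul_cancel₀ (hne x hx)]
  set δ := min (E - a) (b - E) with hδ
  have hKδ : ‖K‖ < δ := lt_min h1 h2
  have hδ0 : 0 < δ := hK0.trans_lt hKδ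
  have hLn : ‖L‖ ≤ δ⁻¹ := by
    refine norm_cfc_le (inv_nonneg.2 hδ0.le) fun x hx => ?_
    rw [norm_inv]
    refine inv_anti₀ hδ0 ?_
    rw [Real.norm_eq_abs]
    rcases hspec x hx with h' | h'
    · exact (min_le_left _ _).trans (by rw [abs_sub_comm]; exact le_trans (by linarith) (le_abs_self _))
    · exact (min_le_right _ _).trans (le_trans (by linarith) (le_abs_self _))
  have hLK : ‖L * K‖ < 1 := by
    calc ‖L * K‖ ≤ ‖L‖ * ‖K‖ := norm_mul_le _ _
      _ ≤ δ⁻¹ * ‖K‖ := by gcongr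
      _ < δ⁻¹ * δ := by gcongr
      _ = 1 := inv_mul_cancel₀ hδ0.ne'
  have hUB : IsUnit (B - (E:ℂ) • 1) := ⟨⟨_, L, hBL, hLB⟩, rfl⟩
  have hM := hUB.mul (isUnit_one_sub_of_norm_lt_one hLK)
  obtain ⟨u, hu⟩ := hM
  have hu' : (u : ℋ →L[ℂ] ℋ) = B - (E:ℂ) • 1 - K := by
    rw [hu, mul_sub, mul_one, ← mul_assoc, hBL, one_mul]
  set X := W - (E:ℂ) • P - K with hX
  set J : ℋ →L[ℂ] ℋ := ((u⁻¹ : (ℋ →L[ℂ] ℋ)ˣ) : ℋ →L[ℂ] ℋ) with hJ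
  have hMJ : (u : ℋ →L[ℂ] ℋ) * J = 1 := u.mul_inv
  have hJM : J * (u : ℋ →L[ℂ] ℋ) = 1 := u.inv_mul
  have hMP : (u : ℋ →L[ℂ] ℋ) * P = X := by
    rw [hu', hB, hX]
    simp only [sub_mul, add_mul, smul_mul_assoc, hP, hWP, hKP, one_mul, sub_self, smul_zero,
      add_zero]
  have hPM : P * (u : ℋ →L[ℂ] ℋ) = X := by
    rw [hu', hB, hX]
    simp only [mul_sub, mul_add, mul_smul_comm, hP, hPW, hPK, mul_one, sub_self, smul_zero,
      add_zero]
  have hPX : P * X = X := by rw [← hPM, ← mul_assoc, hP]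
  have hXP : X * P = X := by rw [← hMP, mul_assoc, hP]
  have hJX : J * X = P := by rw [← hMP, ← mul_assoc, hJM, one_mul]
  have hXJ : X * J = P := by rw [← hPM, mul_assoc, hMJ, mul_one]
  refine ⟨P * J * P, ?_, ?_, ?_⟩
  · change P * (P * J * P * P) = P * J * P
    simp only [mul_assoc, hP]
    simp only [← mul_assoc, hP]
  · change P * J * P * X = P
    rw [mul_assoc, hPX, mul_assoc, hJX, hP]
  · change X * (P * J * P) = P
    rw [← mul_assoc, ← mul_assoc, hXP, hXJ, hP]

namespace FeshbachSetup
section helpers2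
variable {ℋ : Type*} [NormedAddCommGroup ℋ] [InnerProductSpace ℂ ℋ] [CompleteSpace ℋ]
variable {β : ℝ} {S : FeshbachSetup ℋ β}
  {R : ℝ → (ℋ →L[ℂ] ℋ)} (hR : S.IsRedResolvent R) {G : ℋ →L[ℂ] ℋ} (hG : S.IsYInvSqrt R G)
include hR hG

theorem norm_G_le : ‖G‖ ≤ 1 := by
  have h0 : (0:ℝ) ∈ Set.Ico (0 : ℝ) (2 * β) := ⟨le_rfl, by linarith [S.β_pos]⟩
  obtain ⟨g1, g2, g3, g4⟩ := hG
  refine ContinuousLinearMap.opNorm_le_bound _ zero_le_one fun x => ?_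
  rw [one_mul]
  have hPG : S.P (G x) = G x := by
    have h2 := congrArg (fun f : ℋ →L[ℂ] ℋ => f x) g1
    simp only [ContinuousLinearMap.comp_apply] at h2
    rw [← h2, S.P_P]
  have e := congrArg (fun f : ℋ →L[ℂ] ℋ => inner ℂ x (f x)) g4
  simp only [ContinuousLinearMap.comp_apply, Y, _root_.add_apply] at e
  have gs : ∀ y, inner ℂ x (G y) = inner ℂ (G x) y := fun y => by
    rw [← ContinuousLinearMap.adjoint_inner_left, g2]
  rw [gs, inner_add_right, hPG, ContinuousLinearMap.adjoint_inner_right, ← R_symm hR h0,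
    ← S.P_P x, ← S.P_symm] at e
  have e2 : ‖G x‖ ^ 2 + ‖R 0 (S.A (G x))‖ ^ 2 = ‖S.P x‖ ^ 2 := by
    rw [inner_self_eq_norm_sq_to_K, inner_self_eq_norm_sq_to_K,
      inner_self_eq_norm_sq_to_K] at e
    exact_mod_cast e
  have := S.norm_P_le x
  exact le_trans ((sq_le_sq₀ (norm_nonneg _) (norm_nonneg _)).1 (by nlinarith [sq_nonneg ‖R 0 (S.A (G x))‖])) this

theorem main_step {E a b N : ℝ} (hE0 : 0 ≤ E) (hEβ : E ≤ β) (hN : ‖S.T‖ ≤ N)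
    (hgap : ∀ e ∈ Set.Ioo a b, ∃ V, IsCornerInv S.P (S.Htilde R G - (e : ℂ) • S.P) V)
    (h1 : E ^ 2 * N ^ 2 * (β ^ 3)⁻¹ < E - a) (h2 : E ^ 2 * N ^ 2 * (β ^ 3)⁻¹ < b - E) :
    S.IsInvertibleAt E := by
  have hβ := S.β_pos
  have h0 : (0:ℝ) ∈ Set.Ico (0 : ℝ) (2 * β) := ⟨le_rfl, by linarith⟩
  have hE : E ∈ Set.Ico (0 : ℝ) (2 * β) := ⟨hE0, by linarith⟩
  have hGn := norm_G_le hR hG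
  obtain ⟨g1, g2, g3, g4⟩ := hG
  have hP : S.P * S.P = S.P := S.P_idem
  have g1 : S.P * (G * S.P) = G := g1
  have hPG : S.P * G = G := by rw [← g1, ← mul_assoc, hP]
  have hGP : G * S.P = G := by
    conv_rhs => rw [← g1]
    conv_lhs => rw [← g1]
    simp only [mul_assoc, hP]
  set As := ContinuousLinearMap.adjoint S.A with hAs
  have hPAs : S.P * As = As := ContinuousLinearMap.ext fun x => S.P_Aadj x
  have hAP : S.A * S.P = S.A := ContinuousLinearMap.ext fun x => S.A_P x
  have hTP : S.T * S.P = S.T := ContinuousLinearMap.ext fun x => S.T_P x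
  have hY : S.Y R = S.P + As * (R 0 * (R 0 * S.A)) := rfl
  have hPY : S.P * S.Y R = S.Y R := by rw [hY, mul_add, hP, ← mul_assoc, hPAs]
  have hYP : S.Y R * S.P = S.Y R := by
    rw [hY, add_mul, hP]; simp only [mul_assoc, hAP]
  have g4 : G * (S.Y R * G) = S.P := g4
  have hH : S.Htilde R G = G * ((S.P * S.T - As * (R 0 * S.A)) * G) := rfl
  have hexp : R E = R 0 + (E:ℂ) • (R 0 * R 0) + ((E:ℂ)^2) • (R 0 * (R E * R 0)) :=
    ContinuousLinearMap.ext fun x => R_expand hR hE h0 x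
  set F := S.P * S.T - (E:ℂ) • S.P - As * (R E * S.A) with hF
  set K := ((E:ℂ)^2) • (G * (As * (R 0 * (R E * (R 0 * (S.A * G)))))) with hK
  have hGFG : G * (F * G) = S.Htilde R G - (E:ℂ) • S.P - K := by
    have hF2 : F = S.P * S.T - (E:ℂ) • S.P - As * ((R 0 + (E:ℂ) • (R 0 * R 0) +
        ((E:ℂ)^2) • (R 0 * (R E * R 0))) * S.A) := by rw [← hexp]
    have hEP : (E:ℂ) • S.P = (E:ℂ) • (G * ((S.P + As * (R 0 * (R 0 * S.A))) * G)) := by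
      rw [← hY, g4]
    rw [hEP, hH, hK, hF2]
    simp only [mul_add, add_mul, mul_sub, sub_mul, smul_mul_assoc, mul_smul_comm, mul_assoc,
      smul_add, hPG]
    module
  have hnR0 : ‖R 0‖ ≤ β⁻¹ :=
    ContinuousLinearMap.opNorm_le_bound _ (by positivity) (norm_R_le hR h0 hβ.le)
  have hnRE : ‖R E‖ ≤ β⁻¹ :=
    ContinuousLinearMap.opNorm_le_bound _ (by positivity) (norm_R_le hR hE hEβ)
  have hN0 : 0 ≤ N := (norm_nonneg _).trans hN
  have hnA : ‖S.A‖ ≤ N :=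
    (ContinuousLinearMap.opNorm_le_bound _ (norm_nonneg _) S.norm_A_le).trans hN
  have hnAs : ‖As‖ ≤ N := by rw [hAs, LinearIsometryEquiv.norm_map]; exact hnA
  have hKn : ‖K‖ ≤ E ^ 2 * N ^ 2 * (β ^ 3)⁻¹ := by
    have hb : 0 ≤ β⁻¹ := by positivity
    have m : ∀ {X Z : ℋ →L[ℂ] ℋ} {x z : ℝ}, 0 ≤ x → ‖X‖ ≤ x → ‖Z‖ ≤ z → ‖X * Z‖ ≤ x * z :=
      fun h h1 h2 => (norm_mul_le _ _).trans (mul_le_mul h1 h2 (norm_nonneg _) h)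
    rw [hK, norm_smul]
    have := m zero_le_one hGn (m hN0 hnAs (m hb hnR0 (m hb hnRE (m hb hnR0 (m hN0 hnA hGn)))))
    have e : ‖((E:ℂ)^2)‖ = E ^ 2 := by simp
    rw [e]
    calc _ ≤ E ^ 2 * (1 * (N * (β⁻¹ * (β⁻¹ * (β⁻¹ * (N * 1)))))) := by gcongr
      _ = _ := by field_simp
  have hPs : IsSelfAdjoint S.P := S.P_sa
  have hHs : IsSelfAdjoint (S.Htilde R G) := by
    have hGs : IsSelfAdjoint G := g2
    have hPT : star (S.P * S.T) = S.P * S.T := by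
      refine ContinuousLinearMap.ext fun x => ext_inner_left ℂ fun v => ?_
      rw [ContinuousLinearMap.star_eq_adjoint, ContinuousLinearMap.adjoint_inner_right]
      exact S.PT_symm v x
    have hR0 : star (R 0) = R 0 := R_adj hR h0
    have hA1 : star S.A = As := rfl
    have hA2 : star As = S.A := by rw [← hA1, star_star]
    rw [hH, IsSelfAdjoint, star_mul, star_mul, star_sub, hPT, star_mul, star_mul, hR0, hA1, hA2,
      hGs.star_eq]
    simp only [mul_assoc]
  have hPK : S.P * K = K := by rw [hK, mul_smul_comm, ← mul_assoc, hPG]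
  have hKP : K * S.P = K := by rw [hK, smul_mul_assoc]; simp only [mul_assoc, hGP]
  have hPH : S.P * S.Htilde R G = S.Htilde R G := by rw [hH, ← mul_assoc, hPG]
  have hHP : S.Htilde R G * S.P = S.Htilde R G := by rw [hH]; simp only [mul_assoc, hGP]
  obtain ⟨V, hV1, hV2, hV3⟩ := corner_pert S.P _ K hP hPs hHs hPH hHP hPK hKP hgap
    (hKn.trans_lt h1) (hKn.trans_lt h2)
  have hV2 : V * (S.Htilde R G - (E:ℂ) • S.P - K) = S.P := hV2
  have hV3 : (S.Htilde R G - (E:ℂ) • S.P - K) * V = S.P := hV3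
  rw [← hGFG] at hV2 hV3
  have hPF : S.P * F = F := by
    rw [hF, mul_sub, mul_sub, ← mul_assoc, hP, mul_smul_comm, hP, ← mul_assoc, hPAs]
  have hFP : F * S.P = F := by
    rw [hF, sub_mul, sub_mul, smul_mul_assoc, hP]; simp only [mul_assoc, hAP, hTP]
  have hD : G * S.Y R = S.Y R * G := by
    calc G * S.Y R = G * S.Y R * (G * (S.Y R * G)) := by rw [g4, mul_assoc, hYP]
      _ = (G * (S.Y R * G)) * (S.Y R * G) := by simp only [mul_assoc]
      _ = S.Y R * G := by rw [g4, ← mul_assoc, hPY]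
  have hYG : S.Y R * G * G = S.P := by rw [← hD, mul_assoc, g4]
  have hGY : G * (G * S.Y R) = S.P := by rw [hD, g4]
  refine feshbach hR hE (G * V * G) ⟨?_, ?_, ?_⟩
  · change S.P * (G * V * G * S.P) = G * V * G
    rw [mul_assoc, hGP, ← mul_assoc, ← mul_assoc, hPG]
  · change G * V * G * F = S.P
    calc G * V * G * F = G * (V * (G * (F * (G * (G * S.Y R))))) := by
          rw [hGY, hFP]; simp only [mul_assoc]
      _ = G * ((V * (G * (F * G))) * (G * S.Y R)) := by simp only [mul_assoc]
      _ = S.P := by rw [hV2, ← mul_assoc S.P, hPG, hGY]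
  · change F * (G * V * G) = S.P
    calc F * (G * V * G) = (S.Y R * G * G) * F * (G * V * G) := by rw [hYG, hPF]
      _ = (S.Y R * G) * ((G * (F * G)) * V) * G := by simp only [mul_assoc]
      _ = S.P := by rw [hV3, mul_assoc, hPG, hYG]

end helpers2
end FeshbachSetup

/-- If `(C₁, C₂)` is disjoint from the spectrum of `η⁻¹ H̃(η)` for all
`0 < η ≤ min(ε₁, β/(C₂+1))`, then with `C₀ := (C₂+1)²(sup_η ‖H(η)Π(η)‖)²β⁻³` and
`ε₀ := min(ε₁, β/(C₂+1), (C₂-C₁)/(2C₀))`, the interval `(C₁η + C₀η², C₂η - C₀η²)` is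
disjoint from `σ(H(η))` for every `η ∈ (0, ε₀)`. -/
theorem gap_of_order_eta {ℋ : Type*} [NormedAddCommGroup ℋ] [InnerProductSpace ℂ ℋ]
    [CompleteSpace ℋ] {β ε₁ : ℝ} (hε₁ : 0 < ε₁)
    (S : ℝ → FeshbachSetup ℋ β)
    (R : ℝ → ℝ → (ℋ →L[ℂ] ℋ)) (hR : ∀ η ∈ Set.Icc (0 : ℝ) ε₁, (S η).IsRedResolvent (R η))
    (G : ℝ → (ℋ →L[ℂ] ℋ)) (hG : ∀ η ∈ Set.Icc (0 : ℝ) ε₁, (S η).IsYInvSqrt (R η) (G η))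
    (hbdd : BddAbove ((fun η => ‖(S η).T‖) '' Set.Icc 0 ε₁))
    {C₁ C₂ C₀ ε₀ : ℝ} (hC₁ : 0 < C₁) (hC₁₂ : C₁ < C₂)
    (hgap : ∀ η : ℝ, 0 < η → η ≤ min ε₁ (β / (C₂ + 1)) →
      Set.Ioo C₁ C₂ ∩ cornerSpec (S η).P ((η : ℂ)⁻¹ • (S η).Htilde (R η) (G η)) = ∅)
    (hC₀ : C₀ = (C₂ + 1) ^ 2 * sSup ((fun η => ‖(S η).T‖) '' Set.Icc 0 ε₁) ^ 2 * (β ^ 3)⁻¹)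
    (hε₀ : ε₀ = min ε₁ (min (β / (C₂ + 1)) ((C₂ - C₁) / (2 * C₀)))) :
    ∀ η ∈ Set.Ioo (0 : ℝ) ε₀,
      Set.Ioo (C₁ * η + C₀ * η ^ 2) (C₂ * η - C₀ * η ^ 2) ∩ (S η).spec = ∅ := by
  intro η hη
  rw [Set.eq_empty_iff_forall_notMem]
  rintro E ⟨⟨hE1, hE2⟩, hE3⟩
  apply hE3
  obtain ⟨hη0, hη1⟩ := hη
  rw [hε₀] at hη1
  have hηε : η < ε₁ := hη1.trans_le (min_le_left _ _)
  have hηβ : η < β / (C₂ + 1) := hη1.trans_le ((min_le_right _ _).trans (min_le_left _ _))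
  have hβ := (S η).β_pos
  have hmem : η ∈ Set.Icc (0:ℝ) ε₁ := ⟨hη0.le, hηε.le⟩
  set N := sSup ((fun η => ‖(S η).T‖) '' Set.Icc 0 ε₁) with hN
  have hTN : ‖(S η).T‖ ≤ N := le_csSup hbdd ⟨η, hmem, rfl⟩
  have hC2 : 0 < C₂ := hC₁.trans hC₁₂
  have hηβ' : η * (C₂ + 1) < β := (lt_div_iff₀ (by linarith)).1 hηβ
  have hC0 : 0 ≤ C₀ := by rw [hC₀]; positivity
  have hE0 : 0 ≤ E := by
    have : 0 ≤ C₁ * η + C₀ * η ^ 2 := by positivity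
    linarith
  have hEη : E ≤ (C₂ + 1) * η := by nlinarith [mul_nonneg hC0 (sq_nonneg η)]
  have hEβ : E ≤ β := by linarith
  have hq : E ^ 2 * N ^ 2 * (β ^ 3)⁻¹ ≤ C₀ * η ^ 2 := by
    calc E ^ 2 * N ^ 2 * (β ^ 3)⁻¹ ≤ ((C₂ + 1) * η) ^ 2 * N ^ 2 * (β ^ 3)⁻¹ := by gcongr
      _ = C₀ * η ^ 2 := by rw [hC₀]; ring
  refine FeshbachSetup.main_step (hR η hmem) (hG η hmem) hE0 hEβ hTN (a := C₁ * η) (b := C₂ * η)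
    ?_ (by linarith) (by linarith)
  intro e he
  have hg := hgap η hη0 (le_min hηε.le hηβ.le)
  have hnot : e / η ∉ cornerSpec (S η).P ((η : ℂ)⁻¹ • (S η).Htilde (R η) (G η)) := by
    intro h
    have : e / η ∈ (∅ : Set ℝ) := by
      rw [← hg]
      exact ⟨⟨(lt_div_iff₀ hη0).2 he.1, (div_lt_iff₀ hη0).2 he.2⟩, h⟩
    exact this
  obtain ⟨V, hV1, hV2, hV3⟩ := not_not.1 hnot
  have hηc : (η : ℂ) ≠ 0 := by exact_mod_cast hη0.ne'
  have hs : (η : ℂ)⁻¹ • (S η).Htilde (R η) (G η) - ((e / η : ℝ) : ℂ) • (S η).P =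
      (η : ℂ)⁻¹ • ((S η).Htilde (R η) (G η) - (e : ℂ) • (S η).P) := by
    rw [smul_sub, smul_smul, Complex.ofReal_div, div_eq_inv_mul]
  rw [hs] at hV2 hV3
  refine ⟨(η : ℂ)⁻¹ • V, ?_, ?_, ?_⟩
  · rw [ContinuousLinearMap.smul_comp, ContinuousLinearMap.comp_smul, hV1]
  · rw [ContinuousLinearMap.smul_comp, ← ContinuousLinearMap.comp_smul, hV2]
  · rw [ContinuousLinearMap.comp_smul, ← ContinuousLinearMap.smul_comp, hV3]
end
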